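/- arXiv:1702.01058 — 3 statements merged into one kernel-verified Lean document; each statement's English description precedes it below -/
import Mathlib

section
/- For all integers t ≥ 4 and Δ ≥ 3, every finite tree of maximum degree Δ admits a coloring with 2(t+1)(Δ−1)^⌊(t−1)/2⌋ colors that is (1 + 1/t)⁺-free, i.e., in which no factor contains a repetition of exponent strictly greater than 1 + 1/t. -/
open SimpleGraph

/-- The word `w` contains a repetition (period `p`, excess `e`) of exponent at least `β`:
`p ++ e` is a contiguous factor of `w`, `p` is nonempty, `e` is a prefix of `p ++ e`,
and the exponent `(|p| + |e|)/|p|` is at least `β`. -/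
def HasRepGE {α : Type*} (β : ℝ) (w : List α) : Prop :=
  ∃ p e : List α, p ≠ [] ∧ (p ++ e) <:+: w ∧ e <+: (p ++ e) ∧
    β ≤ ((p.length : ℝ) + (e.length : ℝ)) / (p.length : ℝ)

/-- The word `w` contains a repetition of exponent strictly greater than `β`. -/
def HasRepGT {α : Type*} (β : ℝ) (w : List α) : Prop :=
  ∃ p e : List α, p ≠ [] ∧ (p ++ e) <:+: w ∧ e <+: (p ++ e) ∧
    β < ((p.length : ℝ) + (e.length : ℝ)) / (p.length : ℝ)

/-- The coloring `c` of the graph `G` is `β⁺`-free: no factor (word read along the vertices of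
a non-self-intersecting path) contains a repetition of exponent strictly greater than `β`. -/
def ColoringFreePlus {V α : Type*} (G : SimpleGraph V) (c : V → α) (β : ℝ) : Prop :=
  ∀ (u v : V) (p : G.Walk u v), p.IsPath → ¬ HasRepGT β (p.support.map c)

/-- Some factor of the colored graph `(G, c)` is a repetition of exponent at least `β`. -/
def ColoringHasRepGE {V α : Type*} (G : SimpleGraph V) (c : V → α) (β : ℝ) : Prop :=
  ∃ (u v : V) (p : G.Walk u v), p.IsPath ∧ HasRepGE β (p.support.map c)


namespace TreeRep

/-- forward repetition at the head of a word (newest letter first), of period `d`. -/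
def BadR (t : ℕ) {α : Type} (d : ℕ) (l : List α) : Prop :=
  d + (d / t + 1) ≤ l.length ∧ ∀ j < d / t + 1, l[j]? = l[j + d]?

/-- reversed repetition at the head of a word, with inner distance `d`. -/
def BadP (t : ℕ) {α : Type} (d : ℕ) (l : List α) : Prop :=
  d + (d / t + 1) + d / t ≤ l.length ∧ ∀ j < d / t + 1, l[j]? = l[d / t + d + (d / t - j)]?

/-- no bad pattern at the head. -/
def GoodHead (t : ℕ) {α : Type} (l : List α) : Prop :=
  ∀ d, 1 ≤ d → ¬ BadR t d l ∧ (t ≤ d → ¬ BadP t d l)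

open Classical in
/-- the finite set of good words of length `n`. -/
noncomputable def S (t K : ℕ) : ℕ → Finset (List (Fin K))
  | 0 => {[]}
  | n + 1 => ((Finset.univ ×ˢ S t K n).image (fun q => q.1 :: q.2)).filter (GoodHead t)

lemma S_length {t K : ℕ} : ∀ {n : ℕ} {l : List (Fin K)}, l ∈ S t K n → l.length = n := by
  intro n
  induction n with
  | zero => intro l h; simp [S] at h; simp [h]
  | succ n ih =>
    intro l h
    simp only [S, Finset.mem_filter, Finset.mem_image, Finset.mem_product] at h
    obtain ⟨⟨q, hq, rfl⟩, -⟩ := h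
    simp [ih hq.2]

lemma S_drop {t K : ℕ} : ∀ {n : ℕ} {l : List (Fin K)}, l ∈ S t K n → ∀ k ≤ n,
    l.drop k ∈ S t K (n - k) := by
  intro n
  induction n with
  | zero => intro l h k hk; obtain rfl : k = 0 := by omega
            simpa using h
  | succ n ih =>
    intro l h k hk
    rcases k with _ | k
    · simpa using h
    · simp only [S, Finset.mem_filter, Finset.mem_image, Finset.mem_product] at h
      obtain ⟨⟨q, hq, rfl⟩, -⟩ := h
      have := ih hq.2 k (by omega)
      simpa using this

lemma S_good {t K n : ℕ} {l : List (Fin K)} (h : l ∈ S t K (n + 1)) : GoodHead t l := by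
  simp only [S, Finset.mem_filter] at h
  exact h.2

lemma k_le {t d : ℕ} (ht : 4 ≤ t) (hd : 1 ≤ d) : d / t + 1 ≤ d := by
  rcases Nat.lt_or_ge d t with h | h
  · rw [Nat.div_eq_of_lt h]; omega
  · have := Nat.div_mul_le_self d t
    have h2 : d / t * 4 ≤ d / t * t := Nat.mul_le_mul_left _ ht
    omega

open Classical in
/-- all one-letter extensions. -/
noncomputable def Ext (t K n : ℕ) : Finset (List (Fin K)) :=
  (Finset.univ ×ˢ S t K n).image (fun q => q.1 :: q.2)

lemma Ext_card (t K n : ℕ) : (Ext t K n).card = K * (S t K n).card := by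
  unfold Ext
  rw [Finset.card_image_of_injective]
  · simp
  · rintro ⟨a, b⟩ ⟨c, d⟩ h
    simpa using h

lemma Ext_length {t K n : ℕ} {l : List (Fin K)} (h : l ∈ Ext t K n) : l.length = n + 1 := by
  simp only [Ext, Finset.mem_image, Finset.mem_product] at h
  obtain ⟨q, hq, rfl⟩ := h
  simp [S_length hq.2]

lemma Ext_drop {t K n : ℕ} {l : List (Fin K)} (h : l ∈ Ext t K n) (k : ℕ) (hk : k ≤ n) :
    l.drop (k + 1) ∈ S t K (n - k) := by
  simp only [Ext, Finset.mem_image, Finset.mem_product] at h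
  obtain ⟨q, hq, rfl⟩ := h
  simpa using S_drop hq.2 k hk

/-- generic bound: patterns where the first `k+1` letters are determined by the later ones. -/
lemma card_bad_le {t K n k : ℕ} (hk : k ≤ n) (P : List (Fin K) → Prop)
    [DecidablePred P] (φ : ℕ → ℕ)
    (hφ : ∀ j ≤ k, k + 1 ≤ φ j) (hP : ∀ l, P l → ∀ j ≤ k, l[j]? = l[φ j]?) :
    ((Ext t K n).filter P).card ≤ (S t K (n - k)).card := by
  apply Finset.card_le_card_of_injOn (fun l => l.drop (k + 1))
  · intro l hl
    simp only [Finset.coe_filter, Set.mem_ofPred_eq] at hl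
    exact Ext_drop hl.1 k hk
  · intro l hl l' hl' h
    simp only [Finset.coe_filter, Set.mem_ofPred_eq] at hl hl'
    have key : ∀ i, k + 1 ≤ i → l[i]? = l'[i]? := by
      intro i hi
      have := congrArg (fun m => m[i - (k + 1)]?) h
      simp only [List.getElem?_drop] at this
      rwa [Nat.add_sub_cancel' hi] at this
    apply List.ext_getElem?
    intro i
    rcases Nat.lt_or_ge i (k + 1) with hi | hi
    · rw [hP l hl.2 i (by omega), hP l' hl'.2 i (by omega)]
      exact key _ (hφ i (by omega))
    · exact key i hi

lemma wsum (t : ℕ) (ht : 4 ≤ t) (M : ℕ) :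
    ∑ d ∈ Finset.range (t * (M + 1)), (if d < t then (1 : ℝ) else 2 * (1 / 3) ^ (d / t))
      = 2 * t - t * (1 / 3) ^ M := by
  induction M with
  | zero =>
    rw [Finset.sum_congr rfl (g := fun _ => (1 : ℝ))]
    · simp; ring
    · intro d hd
      simp at hd
      simp [hd]
  | succ M ih =>
    rw [show t * (M + 1 + 1) = t * (M + 1) + t by ring, Finset.sum_range_add, ih,
      Finset.sum_congr rfl (g := fun _ => (2 * (1 / 3) ^ (M + 1) : ℝ))]
    · simp [pow_succ]; ring
    · intro d hd
      simp only [Finset.mem_range] at hd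
      have h1 : ¬ (t * (M + 1) + d < t) := by nlinarith
      have h2 : (t * (M + 1) + d) / t = M + 1 := by
        rw [Nat.mul_add_div (by omega), Nat.div_eq_of_lt hd]
      rw [if_neg h1, h2]

lemma wsum' (t : ℕ) (ht : 4 ≤ t) (n : ℕ) :
    ∑ d ∈ Finset.Icc 1 n, (if d < t then (1 : ℝ) else 2 * (1 / 3) ^ (d / t)) ≤ 2 * t - 1 := by
  have h := wsum t ht n
  have hsub : insert 0 (Finset.Icc 1 n) ⊆ Finset.range (t * (n + 1)) := by
    intro d hd
    simp at hd
    simp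
    rcases hd with rfl | hd
    · exact Nat.mul_pos (by omega) (by omega)
    · nlinarith
  have h2 := Finset.sum_le_sum_of_subset_of_nonneg
    (f := fun d => (if d < t then (1 : ℝ) else 2 * (1 / 3) ^ (d / t))) hsub
    (fun d _ _ => by positivity)
  rw [h, Finset.sum_insert (by simp), if_pos (by omega)] at h2
  have : (0 : ℝ) ≤ t * (1 / 3) ^ n := by positivity
  linarith

open Classical in
lemma S_growth (t : ℕ) (ht : 4 ≤ t) (n : ℕ) :
    3 * ((S t (2 * (t + 1)) n).card : ℝ) ≤ (S t (2 * (t + 1)) (n + 1)).card := by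
  induction n using Nat.strong_induction_on with
  | _ n ih =>
  set K := 2 * (t + 1) with hK
  have hpow : ∀ q ≤ n, ((S t K (n - q)).card : ℝ) ≤ (1 / 3) ^ q * (S t K n).card := by
    intro q
    induction q with
    | zero => intro _; simp
    | succ q ihq =>
      intro hq
      have h1 := ih (n - (q + 1)) (by omega)
      rw [show n - (q + 1) + 1 = n - q by omega] at h1
      have h2 := ihq (by omega)
      rw [pow_succ]
      linarith
  have hcover : Ext t K n ⊆ S t K (n + 1) ∪ (Finset.Icc 1 n).biUnion (fun d =>
      (Ext t K n).filter (BadR t d) ∪ (Ext t K n).filter (fun l => t ≤ d ∧ BadP t d l)) := by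
    intro l hl
    by_cases hg : GoodHead t l
    · apply Finset.mem_union_left
      simp only [S, Finset.mem_filter]
      exact ⟨hl, hg⟩
    · apply Finset.mem_union_right
      have hlen := Ext_length hl
      unfold GoodHead at hg
      push Not at hg
      obtain ⟨d, hd, hg⟩ := hg
      simp only [Finset.mem_biUnion, Finset.mem_union, Finset.mem_filter, Finset.mem_Icc]
      by_cases hR : BadR t d l
      · exact ⟨d, ⟨hd, by have := hR.1; have := Nat.zero_le (d / t); omega⟩, Or.inl ⟨hl, hR⟩⟩
      · obtain ⟨h1, h2⟩ := hg hR
        exact ⟨d, ⟨hd, by have := h2.1; have := Nat.zero_le (d / t); omega⟩, Or.inr ⟨hl, h1, h2⟩⟩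
  have hcard := (Finset.card_le_card hcover).trans ((Finset.card_union_le _ _).trans
    (Nat.add_le_add_left Finset.card_biUnion_le _))
  rw [Ext_card] at hcard
  have hterm : ∀ d ∈ Finset.Icc 1 n, ((((Ext t K n).filter (BadR t d) ∪
      (Ext t K n).filter (fun l => t ≤ d ∧ BadP t d l)).card : ℕ) : ℝ) ≤
      (if d < t then (1 : ℝ) else 2 * (1 / 3) ^ (d / t)) * (S t K n).card := by
    intro d hd
    simp only [Finset.mem_Icc] at hd
    have hk := k_le ht hd.1
    have hR : ((Ext t K n).filter (BadR t d)).card ≤ (S t K (n - d / t)).card :=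
      card_bad_le (k := d / t) (by omega) (BadR t d) (fun j => j + d) (fun j _ => by omega)
        (fun l hl j hj => hl.2 j (by omega))
    have hQ : ((Ext t K n).filter (fun l => t ≤ d ∧ BadP t d l)).card
        ≤ (S t K (n - d / t)).card :=
      card_bad_le (k := d / t) (by omega) (fun l => t ≤ d ∧ BadP t d l)
        (fun j => d / t + d + (d / t - j)) (fun j _ => by omega)
        (fun l hl j hj => hl.2.2 j (by omega))
    have hp := hpow (d / t) (by omega)
    have hu := Finset.card_union_le ((Ext t K n).filter (BadR t d))
      ((Ext t K n).filter (fun l => t ≤ d ∧ BadP t d l))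
    split_ifs with hdt
    · have : (Ext t K n).filter (fun l => t ≤ d ∧ BadP t d l) = ∅ := by
        apply Finset.filter_false_of_mem
        intro l _ h
        omega
      rw [this, Finset.union_empty]
      rw [Nat.div_eq_of_lt hdt] at hR
      simp only [one_mul]
      exact_mod_cast hR
    · have h3 : (((Ext t K n).filter (BadR t d) ∪
        (Ext t K n).filter (fun l => t ≤ d ∧ BadP t d l)).card : ℝ) ≤
          2 * (S t K (n - d / t)).card := by
        exact_mod_cast (by omega)
      linarith
  have hsum := Finset.sum_le_sum hterm
  rw [← Finset.sum_mul] at hsum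
  have hw := mul_le_mul_of_nonneg_right (wsum' t ht n)
    (Nat.cast_nonneg (α := ℝ) (S t K n).card)
  have hcard' : (K : ℝ) * (S t K n).card ≤ (S t K (n + 1)).card + ∑ d ∈ Finset.Icc 1 n,
      ((((Ext t K n).filter (BadR t d) ∪
      (Ext t K n).filter (fun l => t ≤ d ∧ BadP t d l)).card : ℕ) : ℝ) := by
    exact_mod_cast hcard
  have hKr : (K : ℝ) = 2 * t + 2 := by rw [hK]; push_cast; ring
  rw [hKr] at hcard'
  linarith

lemma S_nonempty (t : ℕ) (ht : 4 ≤ t) (n : ℕ) : (S t (2 * (t + 1)) n).Nonempty := by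
  rw [← Finset.card_pos]
  induction n with
  | zero => simp [S]
  | succ n ih =>
    have h := S_growth t ht n
    have : (0 : ℝ) < (S t (2 * (t + 1)) n).card := by exact_mod_cast ih
    have h2 : (0 : ℝ) < (S t (2 * (t + 1)) (n + 1)).card := by linarith
    exact_mod_cast h2

/-- The word on levels. -/
lemma exists_word (t : ℕ) (ht : 4 ≤ t) (N : ℕ) : ∃ f : ℕ → Fin (2 * (t + 1)),
    (∀ a d k, 1 ≤ d → d < t * k → a + d + k ≤ N → ∃ j < k, f (a + j) ≠ f (a + d + j)) ∧
    (∀ s d k, 1 ≤ d → 2 ≤ k → d < t * k → k ≤ s + 1 → s + d + k ≤ N →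
      ∃ j < k, f (s - j) ≠ f (s + d + j)) := by
  obtain ⟨l, hl⟩ := S_nonempty t ht N
  have hlen := S_length hl
  let f : ℕ → Fin (2 * (t + 1)) := fun x => (l[N - 1 - x]?).getD 0
  have hf : ∀ x < N, l[N - 1 - x]? = some (f x) := by
    intro x hx
    have : N - 1 - x < l.length := by omega
    simp [f, List.getElem?_eq_getElem this]
  have hgood : ∀ e < N, GoodHead t (l.drop (N - 1 - e)) := by
    intro e he
    have := S_drop hl (N - 1 - e) (by omega)
    rw [show N - (N - 1 - e) = e + 1 by omega] at this
    exact S_good this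
  have hget : ∀ e < N, ∀ j ≤ e, (l.drop (N - 1 - e))[j]? = some (f (e - j)) := by
    intro e he j hj
    rw [List.getElem?_drop, ← hf (e - j) (by omega)]
    congr 1
    omega
  have hdlen : ∀ e < N, (l.drop (N - 1 - e)).length = e + 1 := by
    intro e he
    rw [List.length_drop]; omega
  have hR : ∀ a d k, 1 ≤ d → d < t * k → a + d + k ≤ N →
      ∃ j < k, f (a + j) ≠ f (a + d + j) := by
    intro a d k hd hdk hN
    have hk : d / t + 1 ≤ k := by
      have := (Nat.div_lt_iff_lt_mul (show 0 < t by omega)).2 (by rwa [mul_comm] at hdk)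
      omega
    by_contra! hcon
    have he : a + d + d / t < N := by omega
    refine (hgood _ he d hd).1 ⟨by rw [hdlen _ he]; omega, ?_⟩
    intro j hj
    rw [hget _ he j (by omega), hget _ he (j + d) (by omega)]
    have := hcon (d / t - j) (by omega)
    rw [show a + d + d / t - (j + d) = a + (d / t - j) by omega, this]
    congr 2
    omega
  refine ⟨f, hR, ?_⟩
  intro s d k hd hk2 hdk hks hN
  have hk : d / t + 1 ≤ k := by
    have := (Nat.div_lt_iff_lt_mul (show 0 < t by omega)).2 (by rwa [mul_comm] at hdk)
    omega
  by_contra! hcon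
  rcases Nat.lt_or_ge d t with hdt | hdt
  · obtain ⟨j, hj, h⟩ := hR s d 1 hd (by omega) (by omega)
    obtain rfl : j = 0 := by omega
    exact h (by simpa using hcon 0 (by omega))
  · have he : s + d + d / t < N := by omega
    refine (hgood _ he d hd).2 hdt ⟨by rw [hdlen _ he]; omega, ?_⟩
    intro j hj
    rw [hget _ he j (by omega), hget _ he _ (by omega)]
    have := hcon (d / t - j) (by omega)
    rw [show s + d + d / t - (d / t + d + (d / t - j)) = s - (d / t - j) by omega, this]
    congr 2
    omega

end TreeRep

namespace TreeRep

open SimpleGraph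

lemma exists_word' (t : ℕ) (ht : 4 ≤ t) (N : ℕ) : ∃ f : ℕ → Fin (2 * (t + 1)),
    (∀ a d k, 1 ≤ d → d < t * k → a + d + k ≤ N → ∃ j < k, f (a + j) ≠ f (a + d + j)) ∧
    (∀ a b k, 2 ≤ k → a + k ≤ N → b + k ≤ N → a + k ≤ b + t * k → b + k ≤ a + t * k →
      ∃ j < k, f (a + (k - 1 - j)) ≠ f (b + j)) := by
  obtain ⟨f, hR, hQ⟩ := exists_word t ht N
  have hR1 : ∀ a b, a < b → b < a + t → b < N → f a ≠ f b := by
    intro a b h1 h2 h3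
    obtain ⟨j, hj, h⟩ := hR a (b - a) 1 (by omega) (by omega) (by omega)
    obtain rfl : j = 0 := by omega
    simpa [Nat.add_sub_cancel' h1.le] using h
  have main : ∀ a b k, a ≤ b → 2 ≤ k → b + k ≤ N → b + k ≤ a + t * k →
      (∀ j < k, f (a + (k - 1 - j)) = f (b + j)) → False := by
    intro a b k hab hk hN hd hcon
    rcases Nat.lt_or_ge (a + k - 1) b with h | h
    · obtain ⟨j, hj, hne⟩ := hQ (a + k - 1) (b - (a + k - 1)) k (by omega) hk (by omega)
        (by omega) (by omega)
      apply hne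
      have := hcon j hj
      rw [show a + k - 1 - j = a + (k - 1 - j) by omega, this]
      congr 1
      omega
    · rcases Nat.even_or_odd' (a + b + k - 1) with ⟨m, hm | hm⟩
      · have := hcon (a + k - m) (by omega)
        rw [show a + (k - 1 - (a + k - m)) = m - 1 by omega,
          show b + (a + k - m) = m + 1 by omega] at this
        exact hR1 (m - 1) (m + 1) (by omega) (by omega) (by omega) this
      · have := hcon (a + k - 1 - m) (by omega)
        rw [show a + (k - 1 - (a + k - 1 - m)) = m by omega,
          show b + (a + k - 1 - m) = m + 1 by omega] at this
        exact hR1 m (m + 1) (by omega) (by omega) (by omega) this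
  refine ⟨f, hR, ?_⟩
  intro a b k hk ha hb h1 h2
  by_contra! hcon
  rcases Nat.le_total a b with h | h
  · exact main a b k h hk hb h2 hcon
  · refine main b a k h hk ha h1 ?_
    intro j hj
    have := hcon (k - 1 - j) (by omega)
    rw [show k - 1 - (k - 1 - j) = j by omega] at this
    exact this.symm

lemma shape (L : ℕ → ℕ) (n : ℕ) (h1 : ∀ i < n, L (i + 1) = L i + 1 ∨ L i = L (i + 1) + 1)
    (h2 : ∀ i, i + 2 ≤ n → L (i + 1) = L i + 1 → L (i + 1) ≠ L (i + 2) + 1) :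
    ∃ i ≤ n, (∀ j ≤ i, L j + j = L 0) ∧ (∀ j, i ≤ j → j ≤ n → L j + i = L i + j) := by
  induction n with
  | zero =>
    refine ⟨0, le_rfl, ?_, ?_⟩
    · intro j hj; obtain rfl : j = 0 := by omega
      rfl
    · intro j _ hj; obtain rfl : j = 0 := by omega
      rfl
  | succ n ih =>
    obtain ⟨i, hi, ha, hb⟩ := ih (fun i hi => h1 i (by omega)) (fun i hi => h2 i (by omega))
    rcases Nat.lt_or_ge i n with hin | hin
    · refine ⟨i, by omega, ha, ?_⟩
      intro j hij hj
      rcases Nat.lt_or_ge n j with hj' | hj'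
      · obtain rfl : j = n + 1 := by omega
        have e1 := hb n (by omega) le_rfl
        have e2 := hb (n - 1) (by omega) (by omega)
        have e3 := h1 n (by omega)
        have e4 := h2 (n - 1) (by omega)
        rw [show n - 1 + 1 = n by omega, show n - 1 + 2 = n + 1 by omega] at e4
        have e5 := e4 (by omega)
        omega
      · exact hb j hij hj'
    · obtain rfl : i = n := by omega
      rcases h1 i (by omega) with h | h
      · refine ⟨i, by omega, ha, ?_⟩
        intro j hij hj
        rcases Nat.lt_or_ge i j with hj' | hj'
        · obtain rfl : j = i + 1 := by omega
          omega
        · obtain rfl : j = i := by omega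
          rfl
      · refine ⟨i + 1, le_rfl, ?_, ?_⟩
        · intro j hj
          rcases Nat.lt_or_ge i j with hj' | hj'
          · obtain rfl : j = i + 1 := by omega
            have := ha i le_rfl
            omega
          · exact ha j hj'
        · intro j hij hj
          obtain rfl : j = i + 1 := by omega
          rfl

lemma core {t N K : ℕ} (ht : 4 ≤ t) (f : ℕ → Fin K)
    (hR : ∀ a d k, 1 ≤ d → d < t * k → a + d + k ≤ N → ∃ j < k, f (a + j) ≠ f (a + d + j))
    (hQ : ∀ a b k, 2 ≤ k → a + k ≤ N → b + k ≤ N → a + k ≤ b + t * k → b + k ≤ a + t * k →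
      ∃ j < k, f (a + (k - 1 - j)) ≠ f (b + j))
    (L : ℕ → ℕ) (P k i n : ℕ) (hP : 1 ≤ P) (hk : 1 ≤ k) (hPk : P < t * k) (hn : n + 1 = P + k)
    (hi : i ≤ n)
    (ha : ∀ j ≤ i, L j + j = L 0) (hb : ∀ j, i ≤ j → j ≤ n → L j + i = L i + j)
    (hN : ∀ j ≤ n, L j < N) (heq : ∀ j < k, f (L j) = f (L (j + P))) :
    k = 1 ∧ P = 2 * i := by
  have hR1 : ∀ a b, a < b → b < a + t → b < N → f a ≠ f b := by
    intro a b h1 h2 h3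
    obtain ⟨j, hj, h⟩ := hR a (b - a) 1 (by omega) (by omega) (by omega)
    obtain rfl : j = 0 := by omega
    simpa [Nat.add_sub_cancel' h1.le] using h
  by_cases hi0 : i = 0
  · exfalso
    subst hi0
    have e := hb n (by omega) le_rfl
    have e' := hN n le_rfl
    obtain ⟨j, hj, h⟩ := hR (L 0) P k hP hPk (by omega)
    apply h
    have := heq j hj
    have e1 := hb j (by omega) (by omega)
    have e2 := hb (j + P) (by omega) (by omega)
    rw [show L j = L 0 + j by omega, show L (j + P) = L 0 + P + j by omega] at this
    exact this
  by_cases hin : i = n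
  · exfalso
    subst hin
    have e := ha i le_rfl
    have e' := hN 0 (by omega)
    obtain ⟨j, hj, h⟩ := hR (L i) P k hP hPk (by omega)
    apply h
    have := heq (k - 1 - j) (by omega)
    have e1 := ha (k - 1 - j) (by omega)
    have e2 := ha (k - 1 - j + P) (by omega)
    rw [show L (k - 1 - j) = L i + P + j by omega,
      show L (k - 1 - j + P) = L i + j by omega] at this
    exact this.symm
  have hle := ha i le_rfl
  have hle' := ha (i - 1) (by omega)
  have hri := hb (i + 1) (by omega) (by omega)
  by_cases hik : i + 1 < k
  · exfalso
    have q1 := heq (i - 1) (by omega)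
    have q2 := heq (i + 1) (by omega)
    have e1 := hb (i - 1 + P) (by omega) (by omega)
    have e2 := hb (i + 1 + P) (by omega) (by omega)
    rw [show L (i - 1) = L (i + 1) by omega, q2] at q1
    exact hR1 _ _ (show L (i - 1 + P) < L (i + 1 + P) by omega) (by omega)
      (hN _ (by omega)) q1.symm
  by_cases hiP : P < i
  · exfalso
    have q1 := heq (i - 1 - P) (by omega)
    have q2 := heq (i + 1 - P) (by omega)
    rw [show i - 1 - P + P = i - 1 by omega] at q1
    rw [show i + 1 - P + P = i + 1 by omega] at q2
    have e1 := ha (i - 1 - P) (by omega)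
    have e2 := ha (i + 1 - P) (by omega)
    rw [show L (i - 1) = L (i + 1) by omega, ← q2] at q1
    exact hR1 _ _ (show L (i + 1 - P) < L (i - 1 - P) by omega) (by omega)
      (hN _ (by omega)) q1.symm
  have eP := hb P (by omega) (by omega)
  by_cases hk1 : k = 1
  · subst hk1
    refine ⟨rfl, ?_⟩
    have q := heq 0 (by omega)
    rw [Nat.zero_add] at q
    have n0 := hN 0 (by omega)
    have nP := hN P (by omega)
    rcases Nat.lt_trichotomy (L 0) (L P) with h | h | h
    · exact absurd q (hR1 _ _ h (by omega) nP)
    · omega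
    · exact absurd q.symm (hR1 _ _ h (by omega) n0)
  · exfalso
    have ek := ha (k - 1) (by omega)
    have en := hb n (by omega) le_rfl
    have n0 := hN 0 (by omega)
    have nn := hN n (by omega)
    obtain ⟨j, hj, h⟩ := hQ (L (k - 1)) (L P) k (by omega) (by omega) (by omega)
      (by omega) (by omega)
    apply h
    have e1 := ha j (by omega)
    have e2 := hb (j + P) (by omega) (by omega)
    have q := heq j hj
    rw [show L j = L (k - 1) + (k - 1 - j) by omega, show L (j + P) = L P + j by omega] at q
    exact q

section tree

variable {V : Type*} {G : SimpleGraph V}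

lemma parent_unique (hG : G.IsTree) (r : V) {a b v : V} (ha : G.Adj a v) (hb : G.Adj b v)
    (hla : G.dist r v = G.dist r a + 1) (hlb : G.dist r v = G.dist r b + 1) : a = b := by
  obtain ⟨p, -, hpl⟩ := hG.connected.exists_path_of_dist r a
  obtain ⟨q, -, hql⟩ := hG.connected.exists_path_of_dist r b
  have h1 : (p.concat ha).IsPath := Walk.isPath_of_length_eq_dist _ (by simp; omega)
  have h2 : (q.concat hb).IsPath := Walk.isPath_of_length_eq_dist _ (by simp; omega)
  have h := (hG.existsUnique_path r v).unique h1 h2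
  have := congrArg Walk.penultimate h
  simpa using this

lemma parent_exists (hG : G.IsTree) {r v : V} (hv : v ≠ r) :
    ∃ w, G.Adj v w ∧ G.dist r v = G.dist r w + 1 := by
  obtain ⟨p, -, hpl⟩ := hG.connected.exists_path_of_dist v r
  cases p with
  | nil => exact absurd rfl hv
  | cons h q =>
    rename_i w
    refine ⟨w, h, ?_⟩
    have h1 := dist_le q
    rw [Walk.length_cons] at hpl
    have h2 := hG.dist_eq_dist_add_one_of_adj r h
    rw [dist_comm] at hpl h1
    rw [dist_comm (u := r) (v := w)] at *
    omega

lemma exists_idx [Fintype V] [DecidableRel G.Adj] (hG : G.IsTree) {Δ : ℕ} (hΔ : 3 ≤ Δ)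
    (hdeg : ∀ v : V, G.degree v ≤ Δ) (r : V) (hr : G.degree r ≤ 1) :
    ∃ (par : V → V) (idx : V → Fin (Δ - 1)),
      (∀ a u, G.Adj a u → G.dist r u = G.dist r a + 1 → par u = a) ∧ ∀ a u v, G.Adj a u → G.Adj a v → G.dist r u = G.dist r a + 1 →
      G.dist r v = G.dist r a + 1 → idx u = idx v → u = v := by
  classical
  have hcard : ∀ a, ((G.neighborFinset a).filter (fun v => G.dist r v = G.dist r a + 1)).card
      ≤ Δ - 1 := by
    intro a
    by_cases har : a = r
    · subst har
      have := Finset.card_filter_le (G.neighborFinset a) (fun v => G.dist a v = G.dist a a + 1)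
      rw [card_neighborFinset_eq_degree] at this
      omega
    · obtain ⟨w, hw, hl⟩ := parent_exists hG har
      have hsub : (G.neighborFinset a).filter (fun v => G.dist r v = G.dist r a + 1) ⊆
          (G.neighborFinset a).erase w := by
        intro v hv
        simp only [Finset.mem_filter, mem_neighborFinset] at hv
        simp only [Finset.mem_erase, mem_neighborFinset]
        refine ⟨?_, hv.1⟩
        rintro rfl
        omega
      have h := Finset.card_le_card hsub
      rw [Finset.card_erase_of_mem (by simpa using hw), card_neighborFinset_eq_degree] at h
      have := hdeg a
      omega
  have hinj : ∀ a, ∃ e : V → Fin (Δ - 1), Set.InjOn e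
      ((G.neighborFinset a).filter (fun v => G.dist r v = G.dist r a + 1) : Finset V) := by
    intro a
    have hc := hcard a
    generalize (G.neighborFinset a).filter (fun v => G.dist r v = G.dist r a + 1) = s at hc
    refine ⟨fun v => if h : v ∈ s then Fin.castLE hc (s.equivFin ⟨v, h⟩)
      else ⟨0, by omega⟩, ?_⟩
    intro x hx y hy hxy
    have hx' : x ∈ s := hx
    have hy' : y ∈ s := hy
    simp only [hx', hy', dif_pos] at hxy
    have := s.equivFin.injective (Fin.castLE_injective hc hxy)
    exact congrArg Subtype.val this
  choose e he using hinj
  have hpar : ∀ v, ∃ w, v ≠ r → G.Adj v w ∧ G.dist r v = G.dist r w + 1 := by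
    intro v
    by_cases hv : v = r
    · exact ⟨v, fun h => absurd hv h⟩
    · obtain ⟨w, hw⟩ := parent_exists hG hv
      exact ⟨w, fun _ => hw⟩
  choose par hpar using hpar
  have hp : ∀ a u, G.Adj a u → G.dist r u = G.dist r a + 1 → par u = a := by
    intro a u h1 h2
    have hu : u ≠ r := by
      rintro rfl
      simp at h2
    exact parent_unique hG r (hpar u hu).1.symm h1 (hpar u hu).2 h2
  refine ⟨par, fun v => e (par v) v, hp, ?_⟩
  intro a u v hu hv hlu hlv h
  simp only [hp a u hu hlu, hp a v hv hlv] at h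
  exact he a (by simp [hu, hlu]) (by simp [hv, hlv]) h

/-- Index form of a repetition of large exponent in a word. -/
lemma rep_index {α : Type*} {t : ℕ} (ht : 4 ≤ t) {w : List α} (h : HasRepGT (1 + 1 / (t : ℝ)) w) :
    ∃ s P k, 1 ≤ P ∧ 1 ≤ k ∧ P < t * k ∧ s + P + k ≤ w.length ∧
      ∀ j < k, w[s + j]? = w[s + (j + P)]? := by
  obtain ⟨p, e, hp, ⟨a, b, rfl⟩, hpre, hexp⟩ := h
  have hP : 1 ≤ p.length := List.length_pos_iff.2 hp
  have hPk : p.length < t * e.length := by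
    have h1 : (0 : ℝ) < p.length := by exact_mod_cast hP
    have h2 : (0 : ℝ) < t := by exact_mod_cast (by omega : 0 < t)
    rw [add_div, div_self h1.ne', add_lt_add_iff_left, div_lt_div_iff₀ h2 h1] at hexp
    have : ((p.length : ℕ) : ℝ) < ((t * e.length : ℕ) : ℝ) := by push_cast; linarith
    exact_mod_cast this
  refine ⟨a.length, p.length, e.length, hP, ?_, hPk, by simp; omega, ?_⟩
  · rcases Nat.eq_zero_or_pos e.length with h | h
    · rw [h] at hPk; omega
    · exact h
  · intro j hj
    have key : ∀ i < (p ++ e).length, (a ++ (p ++ e) ++ b)[a.length + i]? = (p ++ e)[i]? := by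
      intro i hi
      rw [List.append_assoc, List.getElem?_append_right (by omega), Nat.add_sub_cancel_left,
        List.getElem?_append_left hi]
    rw [List.length_append] at key
    rw [key j (by omega), key (j + p.length) (by omega),
      List.getElem?_append_right (l₁ := p) (i := j + p.length) (by omega), Nat.add_sub_cancel]
    obtain ⟨c, hc⟩ := hpre
    rw [← hc, List.getElem?_append_left hj]

end tree

end TreeRep

/-- For all `t ≥ 4` and `Δ ≥ 3`, every finite tree of maximum degree `Δ` admits a coloring
with `2(t+1)(Δ−1)^⌊(t−1)/2⌋` colors that is `(1 + 1/t)⁺`-free. -/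
theorem tree_bounded_degree_coloring_free (t Δ : ℕ) (ht : 4 ≤ t) (hΔ : 3 ≤ Δ)
    {V : Type*} [Fintype V] (G : SimpleGraph V) [DecidableRel G.Adj]
    (hG : G.IsTree) (hdeg : ∀ v : V, G.degree v ≤ Δ) :
    ∃ c : V → Fin (2 * (t + 1) * (Δ - 1) ^ ((t - 1) / 2)),
      ColoringFreePlus G c (1 + 1 / (t : ℝ)) := by
  classical
  have hroot : ∃ r : V, G.degree r ≤ 1 := by
    rcases subsingleton_or_nontrivial V with hV | hV
    · obtain ⟨r⟩ := hG.connected.nonempty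
      refine ⟨r, ?_⟩
      have h1 := G.degree_lt_card_verts r
      have h2 := Fintype.card_le_one_iff_subsingleton.2 hV
      omega
    · obtain ⟨r, hr⟩ := hG.exists_vert_degree_one_of_nontrivial
      exact ⟨r, hr.le⟩
  obtain ⟨r, hr⟩ := hroot
  obtain ⟨par, idx, hpar, hidx⟩ := TreeRep.exists_idx hG hΔ hdeg r hr
  obtain ⟨f, hR, hQ⟩ := TreeRep.exists_word' t ht (Finset.univ.sup (fun v => G.dist r v) + 1)
  let c₀ : V → Fin (2 * (t + 1)) × (Fin ((t - 1) / 2) → Fin (Δ - 1)) :=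
    fun v => (f (G.dist r v), fun j => idx (par^[j] v))
  let E : Fin (2 * (t + 1)) × (Fin ((t - 1) / 2) → Fin (Δ - 1)) ≃
      Fin (2 * (t + 1) * (Δ - 1) ^ ((t - 1) / 2)) := Fintype.equivFinOfCardEq (by simp)
  refine ⟨fun v => E (c₀ v), ?_⟩
  intro u v p hp hrep
  obtain ⟨s, P, k, hP, hk, hPk, hlen, heq⟩ := TreeRep.rep_index ht hrep
  rw [List.length_map, Walk.length_support] at hlen
  obtain ⟨n, hn⟩ : ∃ n, n + 1 = P + k := ⟨P + k - 1, by omega⟩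
  -- the vertices of the path
  obtain ⟨x, hx⟩ : ∃ x : ℕ → V, ∀ j, x j = p.getVert (s + j) := ⟨_, fun _ => rfl⟩
  have hadj : ∀ j < n, G.Adj (x j) (x (j + 1)) := by
    intro j hj
    rw [hx, hx]
    exact p.adj_getVert_succ (by omega)
  have hinj : ∀ i ≤ n, ∀ j ≤ n, x i = x j → i = j := by
    intro i hi j hj h
    rw [hx, hx] at h
    have := hp.getVert_injOn (show s + i ≤ p.length by omega) (show s + j ≤ p.length by omega) h
    omega
  have hcol : ∀ j < k, c₀ (x j) = c₀ (x (j + P)) := by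
    intro j hj
    have h := heq j hj
    rw [List.getElem?_map, List.getElem?_map, ← p.getVert_eq_support_getElem? (by omega),
      ← p.getVert_eq_support_getElem? (by omega), ← hx, ← hx] at h
    simpa using h
  have hstep := fun j (hj : j < n) => hG.dist_eq_dist_add_one_of_adj r (hadj j hj)
  obtain ⟨i, hi, ha, hb⟩ := TreeRep.shape (fun j => G.dist r (x j)) n
    (fun j hj => (hstep j hj).symm) (by
      intro j hj h1 h2
      have := TreeRep.parent_unique hG r (hadj j (by omega)) (hadj (j + 1) (by omega)).symm h1 h2
      have := hinj _ (by omega) _ (by omega) this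
      omega)
  obtain ⟨rfl, hPi⟩ := TreeRep.core ht f hR hQ (fun j => G.dist r (x j)) P k i n hP hk hPk hn hi
    ha hb (fun j _ => Nat.lt_succ_of_le
      (Finset.le_sup (f := fun v => G.dist r v) (Finset.mem_univ (x j))))
    (fun j hj => congrArg Prod.fst (hcol j hj))
  have hparL : ∀ j ≤ i, par^[j] (x 0) = x j := by
    intro j
    induction j with
    | zero => intro _; rfl
    | succ j ih =>
      intro hj
      rw [Function.iterate_succ_apply', ih (by omega)]
      have e1 := ha j (by omega)
      have e2 := ha (j + 1) hj
      exact hpar _ _ (hadj j (by omega)).symm (by omega)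
  have hparR : ∀ j ≤ i, par^[j] (x P) = x (P - j) := by
    intro j
    induction j with
    | zero => intro _; rfl
    | succ j ih =>
      intro hj
      rw [Function.iterate_succ_apply', ih (by omega)]
      have e1 := hb (P - j) (by omega) (by omega)
      have e2 := hb (P - (j + 1)) (by omega) (by omega)
      have e3 := hadj (P - (j + 1)) (by omega)
      rw [show P - (j + 1) + 1 = P - j by omega] at e3
      exact hpar _ _ e3 (by omega)
  have hg := congrFun (congrArg Prod.snd (hcol 0 (by omega))) ⟨i - 1, by omega⟩
  simp only [c₀, Nat.zero_add] at hg
  rw [hparL (i - 1) (by omega), hparR (i - 1) (by omega), show P - (i - 1) = i + 1 by omega] at hg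
  have e1 := ha (i - 1) (by omega)
  have e2 := ha i le_rfl
  have e3 := hb (i + 1) (by omega) (by omega)
  have e4 := hadj (i - 1) (by omega)
  rw [show i - 1 + 1 = i by omega] at e4
  have := hidx (x i) (x (i - 1)) (x (i + 1)) e4.symm (hadj i (by omega)) (by omega) (by omega) hg
  have := hinj _ (by omega) _ (by omega) this
  omega
end

section
/- For all integers t ≥ 4 and Δ ≥ 3, let B be the tree consisting of a center vertex of degree Δ together with all vertices at distance at most ⌊t/2⌋ from it in the infinite Δ-regular tree (so B has Δ·((Δ−1)^⌊t/2⌋ − 1)/(Δ−2) + 1 vertices and any two of its vertices are at distance at most t). Then every coloring of B with Δ·((Δ−1)^⌊t/2⌋ − 1)/(Δ−2) colors contains a factor that is a repetition of exponent at least 1 + 1/t. -/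
open SimpleGraph

lemma aux_parent_unique {V : Type*} {G : SimpleGraph V} (hT : G.IsTree) {v₀ u w v : V} {n : ℕ}
    (hu : G.Adj u v) (hw : G.Adj w v) (du : G.dist v₀ u = n) (dw : G.dist v₀ w = n)
    (dv : G.dist v₀ v = n + 1) : u = w := by
  obtain ⟨p, hp⟩ := hT.connected.exists_walk_length_eq_dist v₀ u
  obtain ⟨q, hq⟩ := hT.connected.exists_walk_length_eq_dist v₀ w
  have h1 : (p.concat hu).IsPath := Walk.isPath_of_length_eq_dist _ (by simp [hp, du, dv])
  have h2 : (q.concat hw).IsPath := Walk.isPath_of_length_eq_dist _ (by simp [hq, dw, dv])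
  have h3 : p.concat hu = q.concat hw := (hT.existsUnique_path v₀ v).unique h1 h2
  have h4 := congrArg Walk.penultimate h3
  simpa using h4

lemma aux_sphere {V : Type*} {G : SimpleGraph V} (hT : G.IsTree) {Δ : ℕ} (hΔ : 3 ≤ Δ)
    (hreg : ∀ v : V, (G.neighborSet v).ncard = Δ) (v₀ : V) (n : ℕ) :
    ∃ s : Finset V, (∀ u ∈ s, G.dist v₀ u = n + 1) ∧ Δ * (Δ - 1) ^ n ≤ s.card := by
  classical
  have hfin : ∀ v, (G.neighborSet v).Finite := fun v =>
    Set.finite_of_ncard_ne_zero (by rw [hreg]; omega)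
  have hcard : ∀ v, (hfin v).toFinset.card = Δ := fun v => by
    rw [← Set.ncard_eq_toFinset_card _ (hfin v), hreg]
  induction n with
  | zero =>
    refine ⟨(hfin v₀).toFinset, ?_, by simp [hcard]⟩
    intro u hu
    simpa [dist_eq_one_iff_adj] using hu
  | succ n ih =>
    obtain ⟨s, hs, hc⟩ := ih
    refine ⟨s.biUnion (fun u => (hfin u).toFinset.filter (fun w => G.dist v₀ w = n + 2)), ?_, ?_⟩
    · intro u hu
      simp only [Finset.mem_biUnion, Finset.mem_filter] at hu
      obtain ⟨_, _, _, h⟩ := hu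
      exact h
    · rw [Finset.card_biUnion]
      · have key : ∀ u ∈ s, Δ - 1 ≤
            ((hfin u).toFinset.filter (fun w => G.dist v₀ w = n + 2)).card := by
          intro u hu
          have h1 := Finset.card_filter_add_card_filter_not (s := (hfin u).toFinset)
            (fun w => G.dist v₀ w = n + 2)
          have h2 : ((hfin u).toFinset.filter (fun w => ¬ G.dist v₀ w = n + 2)).card ≤ 1 := by
            rw [Finset.card_le_one]
            intro a ha b hb
            simp only [Finset.mem_filter, Set.Finite.mem_toFinset, mem_neighborSet] at ha hb
            have da := hT.dist_eq_dist_add_one_of_adj v₀ ha.1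
            have db := hT.dist_eq_dist_add_one_of_adj v₀ hb.1
            have := hs u hu
            exact aux_parent_unique hT ha.1.symm hb.1.symm (n := n) (by omega) (by omega) this
          rw [hcard] at h1
          omega
        calc Δ * (Δ - 1) ^ (n + 1) = (Δ * (Δ - 1) ^ n) * (Δ - 1) := by ring
          _ ≤ s.card * (Δ - 1) := Nat.mul_le_mul_right _ hc
          _ = ∑ _u ∈ s, (Δ - 1) := by simp
          _ ≤ _ := Finset.sum_le_sum key
      · intro a ha b hb hab
        rw [Function.onFun, Finset.disjoint_left] 
        intro x hx hy
        simp only [Finset.mem_filter, Set.Finite.mem_toFinset, mem_neighborSet] at hx hy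
        exact hab (aux_parent_unique hT hx.1 hy.1 (hs a ha) (hs b hb) hx.2)

lemma aux_ball {V : Type*} {G : SimpleGraph V} (hT : G.IsTree) {Δ : ℕ} (hΔ : 3 ≤ Δ)
    (hreg : ∀ v : V, (G.neighborSet v).ncard = Δ) (v₀ : V) (m : ℕ) :
    ∃ s : Finset V, (∀ u ∈ s, G.dist v₀ u ≤ m) ∧
      1 + Δ * ∑ i ∈ Finset.range m, (Δ - 1) ^ i ≤ s.card := by
  classical
  induction m with
  | zero => exact ⟨{v₀}, by simp, by simp⟩
  | succ m ih =>
    obtain ⟨s, hs, hc⟩ := ih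
    obtain ⟨s', hs', hc'⟩ := aux_sphere hT hΔ hreg v₀ m
    refine ⟨s ∪ s', ?_, ?_⟩
    · intro u hu
      rcases Finset.mem_union.1 hu with h | h
      · exact (hs u h).trans (by omega)
      · exact (hs' u h).le
    · rw [Finset.card_union_of_disjoint, Finset.sum_range_succ, mul_add]
      · omega
      · rw [Finset.disjoint_left]
        intro x hx hy
        have := hs x hx
        have := hs' x hy
        omega

lemma aux_count {Δ : ℕ} (hΔ : 3 ≤ Δ) (m : ℕ) :
    Δ * ((Δ - 1) ^ m - 1) / (Δ - 2) = Δ * ∑ i ∈ Finset.range m, (Δ - 1) ^ i := by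
  obtain ⟨d, rfl⟩ : ∃ d, Δ = d + 3 := ⟨Δ - 3, by omega⟩
  have h := Nat.geomSum_eq (m := d + 2) (by omega) m
  have h2 : (d + 2) ^ m - 1 = (d + 1) * ∑ i ∈ Finset.range m, (d + 2) ^ i := by
    have := Nat.sub_one_dvd_pow_sub_one (d + 2) m
    rw [h]
    exact (Nat.mul_div_cancel' this).symm
  change (d + 3) * ((d + 2) ^ m - 1) / (d + 1) = (d + 3) * ∑ i ∈ Finset.range m, (d + 2) ^ i
  rw [h2, Nat.mul_left_comm, Nat.mul_div_cancel_left _ (by omega)]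

lemma aux_walk {V : Type*} {G : SimpleGraph V} (hT : G.IsTree) (v₀ : V) (r : ℕ)
    (z x : {u : V | G.dist v₀ u ≤ r}) (hz : z.1 = v₀) :
    ∃ p : (G.induce {u : V | G.dist v₀ u ≤ r}).Walk z x, p.length ≤ r := by
  classical
  obtain ⟨z, hz'⟩ := z
  obtain ⟨x, hx⟩ := x
  change z = v₀ at hz
  subst hz
  obtain ⟨p, hp⟩ := hT.connected.exists_walk_length_eq_dist z x
  have hmem : ∀ y ∈ p.support, y ∈ {u : V | G.dist z u ≤ r} := by
    intro y hy
    have h1 := dist_le (p.takeUntil y hy)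
    have h2 := p.length_takeUntil_le_length hy
    simp only [Set.mem_ofPred_eq] at hx ⊢
    omega
  refine ⟨p.induce _ hmem, ?_⟩
  have h := congrArg List.length (Walk.support_induce p hmem)
  simp only [Walk.length_support, List.length_attachWith] at h
  simp only [Set.mem_ofPred_eq] at hx
  omega

/-- For all `t ≥ 4` and `Δ ≥ 3`: in the infinite `Δ`-regular tree (a tree in which every
vertex has exactly `Δ` neighbors), let `B` be the subgraph induced by the ball of radius
`⌊t/2⌋` around a vertex `v₀`. Then every coloring of `B` with
`Δ·((Δ−1)^⌊t/2⌋ − 1)/(Δ−2)` colors contains a factor that is a repetition of exponent at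
least `1 + 1/t`. -/
theorem ball_in_regular_tree_hasRep {V : Type*} (G : SimpleGraph V) (hT : G.IsTree)
    (t Δ : ℕ) (ht : 4 ≤ t) (hΔ : 3 ≤ Δ)
    (hreg : ∀ v : V, (G.neighborSet v).ncard = Δ) (v₀ : V)
    (c : {u : V // G.dist v₀ u ≤ t / 2} → Fin (Δ * ((Δ - 1) ^ (t / 2) - 1) / (Δ - 2))) :
    ColoringHasRepGE (G.induce {u : V | G.dist v₀ u ≤ t / 2}) c (1 + 1 / (t : ℝ)) := by
  classical
  obtain ⟨s, hs, hc⟩ := aux_ball hT hΔ hreg v₀ (t / 2)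
  rw [← aux_count hΔ] at hc
  obtain ⟨x, -, y, -, hxy, hcol⟩ := Finset.exists_ne_map_eq_of_card_lt_of_maps_to
    (s := s.attach) (t := Finset.univ) (f := fun u => c ⟨u.1, hs u.1 u.2⟩)
    (by simp only [Finset.card_univ, Fintype.card_fin, Finset.card_attach]; omega)
    (by intro a _; simp)
  let X : {u : V | G.dist v₀ u ≤ t / 2} := ⟨x.1, hs x.1 x.2⟩
  let Y : {u : V | G.dist v₀ u ≤ t / 2} := ⟨y.1, hs y.1 y.2⟩
  have hXY : X ≠ Y := fun h => hxy (Subtype.ext (Subtype.mk.inj h))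
  have hcXY : c X = c Y := hcol
  let z : {u : V | G.dist v₀ u ≤ t / 2} := ⟨v₀, by simp⟩
  obtain ⟨p, hp⟩ := aux_walk hT v₀ (t / 2) z X rfl
  obtain ⟨q, hq⟩ := aux_walk hT v₀ (t / 2) z Y rfl
  have hlen : (p.reverse.append q).bypass.length ≤ t := by
    have := (p.reverse.append q).length_bypass_le_length
    simp only [Walk.length_append, Walk.length_reverse] at this
    omega
  have hpath := (p.reverse.append q).bypass_isPath
  generalize (p.reverse.append q).bypass = w at hlen hpath
  refine ⟨X, Y, w, hpath, ?_⟩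
  clear_value X Y
  cases w with
  | nil => exact absurd rfl hXY
  | cons hadj w' =>
    have hw : w'.support = w'.support.dropLast ++ [Y] := by
      conv_lhs => rw [← List.dropLast_append_getLast w'.support_ne_nil]
      rw [Walk.getLast_support]
    have hL : w'.support.dropLast.length = w'.length := by simp
    generalize w'.support.dropLast = l at hw hL
    refine ⟨c X :: (l.map c), [c Y], by simp, ?_, ?_, ?_⟩
    · rw [Walk.support_cons, hw]
      simp
    · simp [hcXY]
    · have ht0 : (0 : ℝ) < t := by exact_mod_cast (by omega : 0 < t)
      rw [Walk.length_cons] at hlen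
      have hlen' : (w'.length : ℝ) + 1 ≤ t := by exact_mod_cast hlen
      simp only [List.length_cons, List.length_map, hL, List.length_nil]
      push_cast
      have hpos : (0 : ℝ) < (w'.length : ℝ) + 1 := by positivity
      rw [add_div, div_self hpos.ne']
      gcongr
end

section
/- Let A be an alphabet and let m be the morphism from words over A to words over A × {0,1} that maps each letter a to the two-letter word (a,0)(a,1) (the doubling morphism). For every finite word w over A and every real β: if m(w) contains a repetition of exponent at least β, then w contains a repetition of exponent at least β. -/
open SimpleGraph

/-- The doubling morphism: each letter `a` is mapped to the two-letter word `(a,0)(a,1)`,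
extended to words by concatenation. -/
def doublingMorphism {A : Type*} (w : List A) : List (A × Bool) :=
  w.flatMap (fun a => [(a, false), (a, true)])

theorem hasRepGE_iff_index {α : Type*} (β : ℝ) (w : List α) :
    HasRepGE β w ↔ ∃ i q f : ℕ, 0 < q ∧ i + q + f ≤ w.length ∧
      (∀ k < f, w[i + k]? = w[i + q + k]?) ∧ β ≤ ((q : ℝ) + f) / q := by
  constructor
  · rintro ⟨p, e, hp, ⟨s, t, rfl⟩, he, hb⟩
    refine ⟨s.length, p.length, e.length, List.length_pos_iff.2 hp, ?_, ?_, hb⟩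
    · simp; omega
    · intro k hk
      have h1 : (p ++ e)[k]? = e[k]? := by
        rw [List.prefix_iff_getElem?] at he
        rw [he k hk, List.getElem?_eq_getElem hk]
      have h2 : (s ++ (p ++ e) ++ t)[s.length + k]? = (p ++ e)[k]? := by
        rw [List.append_assoc, List.getElem?_append_right (by omega),
          List.getElem?_append_left (by simp; omega)]
        congr 1; omega
      have h3 : (s ++ (p ++ e) ++ t)[s.length + p.length + k]? = e[k]? := by
        rw [List.append_assoc, List.getElem?_append_right (by omega),
          List.getElem?_append_left (by simp; omega),
          List.getElem?_append_right (by omega)]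
        congr 1; omega
      rw [h2, h3, h1]
  · rintro ⟨i, q, f, hq, hl, hk, hb⟩
    have hpe : (w.drop i).take q ++ (w.drop (i + q)).take f = (w.drop i).take (q + f) := by
      rw [List.take_add, List.drop_drop]
    refine ⟨(w.drop i).take q, (w.drop (i + q)).take f, ?_, ?_, ?_, ?_⟩
    · rw [← List.length_pos_iff]; simp; omega
    · rw [hpe]
      exact (List.take_prefix _ _).isInfix.trans (List.drop_suffix _ _).isInfix
    · rw [hpe]
      have : (w.drop (i + q)).take f = (w.drop i).take f := by
        apply List.ext_getElem?
        intro k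
        rw [List.getElem?_take, List.getElem?_take]
        split_ifs with h
        · rw [List.getElem?_drop, List.getElem?_drop, hk k h]
        · rfl
      rw [this]
      exact List.take_prefix_take_left (by omega)
    · have h1 : ((w.drop i).take q).length = q := by simp; omega
      have h2 : ((w.drop (i + q)).take f).length = f := by simp; omega
      rw [h1, h2]; exact hb

theorem doublingMorphism_length {A : Type*} (w : List A) :
    (doublingMorphism w).length = 2 * w.length := by
  induction w with
  | nil => rfl
  | cons a w ih =>
    have : doublingMorphism (a :: w) = (a, false) :: (a, true) :: doublingMorphism w := rfl
    rw [this]; simp [ih]; omega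

theorem doublingMorphism_getElem? {A : Type*} (w : List A) (k : ℕ) :
    (doublingMorphism w)[k]? = w[k / 2]?.map (fun a => (a, decide (k % 2 = 1))) := by
  induction w generalizing k with
  | nil => simp [doublingMorphism]
  | cons a w ih =>
    have : doublingMorphism (a :: w) = (a, false) :: (a, true) :: doublingMorphism w := rfl
    rw [this]
    match k with
    | 0 => simp
    | 1 => simp
    | k + 2 =>
      have h : (k + 2) / 2 = k / 2 + 1 := by omega
      simp [ih, h]

/-- If the image of a word `w` under the doubling morphism contains a repetition of exponent
at least `β`, then `w` itself contains a repetition of exponent at least `β`. -/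
theorem doubling_morphism_reflects_repetitions {A : Type*} (w : List A) (β : ℝ)
    (h : HasRepGE β (doublingMorphism w)) : HasRepGE β w := by
  rw [hasRepGE_iff_index] at h ⊢
  obtain ⟨i, q, f, hq, hl, hk, hb⟩ := h
  rw [doublingMorphism_length] at hl
  rcases Nat.eq_zero_or_pos f with rfl | hf
  · refine ⟨0, 1, 0, by omega, by omega, by simp, ?_⟩
    have : (q : ℝ) ≠ 0 := by positivity
    simpa [this] using hb
  · have key : ∀ k < f, q % 2 = 0 ∧ w[(i + k) / 2]? = w[(i + q + k) / 2]? := by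
      intro k hkf
      have h := hk k hkf
      have l1 : (i + k) / 2 < w.length := by omega
      have l2 : (i + q + k) / 2 < w.length := by omega
      rw [doublingMorphism_getElem?, doublingMorphism_getElem?, List.getElem?_eq_getElem l1,
        List.getElem?_eq_getElem l2] at h
      simp only [Option.map_some, Option.some.injEq, Prod.mk.injEq, decide_eq_decide] at h
      refine ⟨by omega, ?_⟩
      rw [List.getElem?_eq_getElem l1, List.getElem?_eq_getElem l2, h.1]
    have hq2 := (key 0 hf).1
    obtain ⟨r, rfl⟩ : ∃ r, q = 2 * r := ⟨q / 2, by omega⟩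
    obtain ⟨g, hg⟩ : ∃ g, g = (i + f - 1) / 2 - i / 2 + 1 := ⟨_, rfl⟩
    refine ⟨i / 2, r, g, by omega, by omega, ?_, hb.trans ?_⟩
    · intro k hkg
      have h := (key (2 * (i / 2 + k) - i) (by omega)).2
      have e1 : (i + (2 * (i / 2 + k) - i)) / 2 = i / 2 + k := by omega
      have e2 : (i + 2 * r + (2 * (i / 2 + k) - i)) / 2 = i / 2 + r + k := by omega
      rwa [e1, e2] at h
    · have hr : (0 : ℝ) < r := by exact_mod_cast (by omega : 0 < r)
      have hfg : (f : ℝ) ≤ 2 * g := by exact_mod_cast (by omega : f ≤ 2 * g)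
      push_cast
      rw [div_le_div_iff₀ (by positivity) hr]
      nlinarith
end
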